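/- Let an SSSCG have weakly monotonic leader's and followers' cost functions. Let σ_ℓ be any leader strategy, ν ∈ E^{σ_ℓ}, and let i* minimize c_{i,ℓ}(ν_i + 1) over the resources i with σ_ℓ(i) > 0. Let σ̂_ℓ be the pure leader strategy with σ̂_ℓ(i*) = 1. Then there exists a configuration ν̂ ∈ E^{σ̂_ℓ} with ν̂_{i*} ≤ ν_{i*}; consequently c_ℓ^{(σ̂_ℓ,ν̂)} = c_{i*,ℓ}(ν̂_{i*} + 1) ≤ c_ℓ^{(σ_ℓ,ν)}. -/

import Mathlib

open Finset

/-- A leader strategy: a probability distribution over the resources. -/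
def IsStrategy {R : Type} [Fintype R] (σ : R → ℚ) : Prop :=
  (∀ i, 0 ≤ σ i) ∧ ∑ i, σ i = 1

/-- A followers' configuration: `nF` followers distributed over the resources. -/
def IsConfig {R : Type} [Fintype R] (nF : ℕ) (ν : R → ℕ) : Prop :=
  ∑ i, ν i = nF

/-- Followers' expected cost of a resource with cost function `c`, selected by the leader
with probability `p`, when `x` followers select it. -/
def expCost (c : ℕ → ℚ) (p : ℚ) (x : ℕ) : ℚ := p * c (x + 1) + (1 - p) * c x

/-- `ν` is a Nash equilibrium of the followers' game induced by the leader's strategy `σ`. -/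
def IsNE {R : Type} [Fintype R] (cf : R → ℕ → ℚ) (σ : R → ℚ) (ν : R → ℕ) : Prop :=
  ∀ i j, i ≠ j → 0 < ν i → expCost (cf i) (σ i) (ν i) ≤ expCost (cf j) (σ j) (ν j + 1)

/-- The leader's expected cost. -/
def leaderCost {R : Type} [Fintype R] (cl : R → ℕ → ℚ) (σ : R → ℚ) (ν : R → ℕ) : ℚ :=
  ∑ i, σ i * cl i (ν i + 1)

/-- The pure leader strategy on resource `i`. -/
def pureStrat {R : Type} [DecidableEq R] (i : R) : R → ℚ := fun j => if j = i then 1 else 0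

/-- The configuration obtained from `μ` when one follower moves from resource `i` to `j`. -/
def moveFollower {R : Type} [DecidableEq R] (μ : R → ℕ) (i j : R) : R → ℕ :=
  Function.update (Function.update μ i (μ i - 1)) j (μ j + 1)

/-- Rosenthal's potential of the followers' singleton congestion game with costs `d`. -/
def rosenthalPotential {R : Type} [Fintype R] (d : R → ℕ → ℚ) (μ : R → ℕ) : ℚ :=
  ∑ i, ∑ x ∈ range (μ i), d i (x + 1)

theorem moveFollower_source {R : Type} [DecidableEq R] (μ : R → ℕ) {i j : R} (hij : i ≠ j) :
    moveFollower μ i j i = μ i - 1 := by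
  simp [moveFollower, hij]

theorem sum_moveFollower {R M : Type} [Fintype R] [DecidableEq R] [AddCommMonoid M]
    (g : R → ℕ → M) (μ : R → ℕ) {i j : R} (hij : i ≠ j) :
    ∑ k, g k (moveFollower μ i j k) + (g i (μ i) + g j (μ j)) =
      ∑ k, g k (μ k) + (g i (μ i - 1) + g j (μ j + 1)) := by
  have split : ∀ f : R → M, ∑ k, f k = f i + (f j + ∑ k ∈ (univ.erase i).erase j, f k) := by
    intro f
    rw [add_sum_erase _ f (by simp [hij.symm]), add_sum_erase _ f (mem_univ i)]
  have rest : ∑ k ∈ (univ.erase i).erase j, g k (moveFollower μ i j k) =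
      ∑ k ∈ (univ.erase i).erase j, g k (μ k) := by
    refine sum_congr rfl fun k hk => ?_
    simp only [mem_erase, mem_univ, and_true] at hk
    simp [moveFollower, hk.1, hk.2]
  rw [split, split fun k => g k (μ k), rest, moveFollower_source μ hij,
    show moveFollower μ i j j = μ j + 1 by simp [moveFollower]]
  abel

theorem IsConfig.moveFollower {R : Type} [Fintype R] [DecidableEq R] {nF : ℕ} {μ : R → ℕ}
    (hμ : IsConfig nF μ) {i j : R} (hij : i ≠ j) (hi : 0 < μ i) :
    IsConfig nF (moveFollower μ i j) := by
  have h := sum_moveFollower (fun _ x => x) μ hij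
  unfold IsConfig at *
  omega

theorem rosenthalPotential_moveFollower {R : Type} [Fintype R] [DecidableEq R]
    (d : R → ℕ → ℚ) (μ : R → ℕ) {i j : R} (hij : i ≠ j) (hi : 0 < μ i) :
    rosenthalPotential d (moveFollower μ i j) =
      rosenthalPotential d μ + d j (μ j + 1) - d i (μ i) := by
  have h := sum_moveFollower (fun k n => ∑ x ∈ range n, d k (x + 1)) μ hij
  obtain ⟨n, hn⟩ := Nat.exists_eq_succ_of_ne_zero hi.ne'
  simp only [hn, Nat.succ_eq_add_one, Nat.add_sub_cancel, sum_range_succ] at h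
  rw [hn]
  unfold rosenthalPotential
  linarith

/-- Among the configurations of minimum potential there is one of least load on `r`. -/
theorem exists_minimal_potential {R : Type} [Fintype R] [DecidableEq R] {nF : ℕ}
    (d : R → ℕ → ℚ) (r : R) {ν : R → ℕ} (hν : IsConfig nF ν) :
    ∃ μ, IsConfig nF μ ∧ ∀ μ', IsConfig nF μ' →
      rosenthalPotential d μ ≤ rosenthalPotential d μ' ∧
        (rosenthalPotential d μ' = rosenthalPotential d μ → μ r ≤ μ' r) := by
  have hmem : ∀ μ : R → ℕ, μ ∈ piAntidiag univ nF ↔ IsConfig nF μ := by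
    simp [IsConfig]
  obtain ⟨μ, hμ, hmin⟩ := exists_min_image (piAntidiag univ nF)
    (fun μ => toLex (rosenthalPotential d μ, μ r)) ⟨ν, (hmem ν).2 hν⟩
  refine ⟨μ, (hmem μ).1 hμ, fun μ' hμ' => ?_⟩
  have h := hmin μ' ((hmem μ').2 hμ')
  rw [Prod.Lex.toLex_le_toLex] at h
  rcases h with h | ⟨h, h'⟩
  · exact ⟨h.le, fun he => absurd he h.ne'⟩
  · exact ⟨h.le, fun _ => h'⟩

theorem expCost_mem_Icc {c : ℕ → ℚ} (hc : Monotone c) {p : ℚ} (hp0 : 0 ≤ p) (hp1 : p ≤ 1)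
    (x : ℕ) : expCost c p x ∈ Set.Icc (c x) (c (x + 1)) := by
  have h := hc x.le_succ
  rw [Nat.succ_eq_add_one] at h
  unfold expCost
  constructor <;> nlinarith

theorem IsStrategy.le_one {R : Type} [Fintype R] {σ : R → ℚ} (hσ : IsStrategy σ) (i : R) :
    σ i ≤ 1 :=
  hσ.2 ▸ single_le_sum (fun k _ => hσ.1 k) (mem_univ i)

theorem exists_isNE_pureStrat {R : Type} [Fintype R] [DecidableEq R] {nF : ℕ}
    {cf : R → ℕ → ℚ} (hf : ∀ i, Monotone (cf i)) {σ : R → ℚ} (hσ : IsStrategy σ)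
    {ν : R → ℕ} (hν : IsConfig nF ν) (hNE : IsNE cf σ ν) (r : R) :
    ∃ μ : R → ℕ, IsConfig nF μ ∧ IsNE cf (pureStrat r) μ ∧ μ r ≤ ν r := by
  obtain ⟨μ, hμ, hmin⟩ :=
    exists_minimal_potential (fun i => expCost (cf i) (pureStrat r i)) r hν
  have hmove {i j : R} (hij : i ≠ j) (hi : 0 < μ i) :=
    rosenthalPotential_moveFollower (fun i => expCost (cf i) (pureStrat r i)) μ hij hi
  have hNEμ : IsNE cf (pureStrat r) μ := by
    intro i j hij hi
    have h := (hmin _ (hμ.moveFollower hij hi)).1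
    rw [hmove hij hi] at h
    linarith
  refine ⟨μ, hμ, hNEμ, ?_⟩
  by_contra! hlt
  obtain ⟨j, -, hj⟩ : ∃ j ∈ univ, μ j < ν j := by
    by_contra! hall
    have h := sum_lt_sum hall ⟨r, mem_univ r, hlt⟩
    unfold IsConfig at hμ hν
    omega
  have hrj : r ≠ j := by
    rintro rfl
    omega
  have hr : 0 < μ r := by omega
  have hcost : expCost (cf j) (pureStrat r j) (μ j + 1) ≤
      expCost (cf r) (pureStrat r r) (μ r) :=
    calc expCost (cf j) (pureStrat r j) (μ j + 1)
      _ = cf j (μ j + 1) := by simp [expCost, pureStrat, hrj.symm]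
      _ ≤ cf j (ν j) := hf j hj
      _ ≤ expCost (cf j) (σ j) (ν j) := (expCost_mem_Icc (hf j) (hσ.1 j) (hσ.le_one j) _).1
      _ ≤ expCost (cf r) (σ r) (ν r + 1) := hNE j r hrj.symm (by omega)
      _ ≤ cf r (ν r + 1 + 1) := (expCost_mem_Icc (hf r) (hσ.1 r) (hσ.le_one r) _).2
      _ ≤ cf r (μ r + 1) := hf r (by omega)
      _ = expCost (cf r) (pureStrat r r) (μ r) := by simp [expCost, pureStrat]
  have hm := hmin _ (hμ.moveFollower hrj hr)
  have heq := hmove hrj hr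
  have hload := hm.2 (by linarith [hm.1])
  rw [moveFollower_source μ hrj] at hload
  omega

/-- Given any leader strategy `σ`, an NE `ν` for it, and a resource `i*` of minimum leader's
cost among those played with positive probability, the pure commitment on `i*` admits an NE
`ν̂` with `ν̂_{i*} ≤ ν_{i*}`, whose leader's cost `c_{i*,ℓ}(ν̂_{i*}+1)` is at most the
leader's cost of `(σ, ν)`. -/
theorem stmt4 {R : Type} [Fintype R] [DecidableEq R] (nF : ℕ)
    (cl cf : R → ℕ → ℚ)
    (hl0 : ∀ i, cl i 0 = 0) (hf0 : ∀ i, cf i 0 = 0)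
    (hlmono : ∀ i x, cl i x ≤ cl i (x + 1)) (hfmono : ∀ i x, cf i x ≤ cf i (x + 1))
    (σ : R → ℚ) (hσ : IsStrategy σ)
    (ν : R → ℕ) (hν : IsConfig nF ν) (hNE : IsNE cf σ ν)
    (istar : R) (hpos : 0 < σ istar)
    (hmin : ∀ i, 0 < σ i → cl istar (ν istar + 1) ≤ cl i (ν i + 1)) :
    ∃ νh : R → ℕ, IsConfig nF νh ∧ IsNE cf (pureStrat istar) νh ∧
      νh istar ≤ ν istar ∧
      leaderCost cl (pureStrat istar) νh = cl istar (νh istar + 1) ∧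
      leaderCost cl (pureStrat istar) νh ≤ leaderCost cl σ ν := by
  obtain ⟨νh, hc, hn, hle⟩ :=
    exists_isNE_pureStrat (fun i => monotone_nat_of_le_succ (hfmono i)) hσ hν hNE istar
  have hcost : leaderCost cl (pureStrat istar) νh = cl istar (νh istar + 1) := by
    simp [leaderCost, pureStrat]
  refine ⟨νh, hc, hn, hle, hcost, ?_⟩
  calc leaderCost cl (pureStrat istar) νh
    _ = cl istar (νh istar + 1) := hcost
    _ ≤ cl istar (ν istar + 1) := monotone_nat_of_le_succ (hlmono istar) (by omega)
    _ = ∑ i, σ i * cl istar (ν istar + 1) := by rw [← sum_mul, hσ.2, one_mul]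
    _ ≤ leaderCost cl σ ν := by
      refine sum_le_sum fun i _ => ?_
      rcases (hσ.1 i).eq_or_lt with h | h
      · simp [← h]
      · exact mul_le_mul_of_nonneg_left (hmin i h) h.le
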